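/- Let l ≥ 1 be an integer, ρ > 0, and let T_l denote the differential operation (T_l g)(r) = -g''(r) + l(l+1) g(r)/r^2 on (0,∞). If g : (0,∞) → ℂ is twice differentiable, satisfies (T_l g)(r) = i ρ^2 g(r) for all r > 0, and is square integrable on (0,∞), then g is identically zero. (Hence the operators T_l for l ≥ 1 have deficiency indices (0,0) and are essentially self-adjoint.) -/

import Mathlib

open Set MeasureTheory

/-- The second-order differential operation
`(T_l u)(r) = -u''(r) + l(l+1) u(r)/r^2` on `(0,∞)`. -/
noncomputable def Tl (l : ℕ) (u : ℝ → ℂ) : ℝ → ℂ :=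
  fun r => -(deriv (deriv u) r) + ((l : ℂ) * ((l : ℂ) + 1)) * u r / (r : ℂ) ^ 2

/-- If `u` is nonnegative, integrable on `(0,∞)` and satisfies `u'' ≥ 4 u / r²` there,
then `u` vanishes on `(0,∞)`. -/
lemma eq_zero_of_integrableOn_of_deriv2_ge {u w z : ℝ → ℝ}
    (hu : ∀ r ∈ Ioi (0 : ℝ), HasDerivAt u (w r) r)
    (hw : ∀ r ∈ Ioi (0 : ℝ), HasDerivAt w (z r) r)
    (hnn : ∀ r, 0 ≤ u r)
    (hz : ∀ r ∈ Ioi (0 : ℝ), 4 * u r ≤ r ^ 2 * z r)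
    (hint : IntegrableOn u (Ioi 0)) :
    ∀ r ∈ Ioi (0 : ℝ), u r = 0 := by
  intro a ha
  have ha0 : 0 < a := ha
  by_contra hne
  have hpos : 0 < u a := lt_of_le_of_ne (hnn a) (Ne.symm hne)
  have hwmono : MonotoneOn w (Ioi 0) := by
    refine monotoneOn_of_hasDerivWithinAt_nonneg (convex_Ioi 0)
      (fun r hr => (hw r hr).continuousAt.continuousWithinAt)
      (f' := z) (fun r hr => (hw r (interior_subset hr)).hasDerivWithinAt) fun r hr => ?_
    have hr' : (0 : ℝ) < r := interior_subset hr
    have h1 := hz r hr'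
    have h2 := hnn r
    exact nonneg_of_mul_nonneg_right (by linarith : 0 ≤ r ^ 2 * z r) (by positivity)
  -- Otherwise `u ≥ u a` on `(a,∞)`, which contradicts integrability.
  have hwa : w a ≤ 0 := by
    by_contra! hwa
    have humono : MonotoneOn u (Ici a) := by
      refine monotoneOn_of_hasDerivWithinAt_nonneg (convex_Ici a)
        (fun r hr => (hu r (ha0.trans_le hr)).continuousAt.continuousWithinAt)
        (f' := w)
        (fun r hr => (hu r (ha0.trans_le (interior_subset hr : r ∈ Ici a))).hasDerivWithinAt)
        fun r hr => ?_
      have hr' : a ≤ r := interior_subset hr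
      exact hwa.le.trans (hwmono ha (ha0.trans_le hr') hr')
    have hc : IntegrableOn (fun _ : ℝ => u a) (Ioi a) := by
      refine Integrable.mono' (hint.mono_set (Ioi_subset_Ioi ha0.le))
        aestronglyMeasurable_const ?_
      filter_upwards [ae_restrict_mem measurableSet_Ioi] with r hr
      rw [Real.norm_of_nonneg hpos.le]
      exact humono self_mem_Ici (mem_Ici.2 (le_of_lt hr)) (le_of_lt hr)
    rw [integrableOn_const_iff] at hc
    simp [hne] at hc
  set Q : ℝ → ℝ := fun r => r ^ 2 * w r - 2 * r * u r with hQ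
  have hQmono : MonotoneOn Q (Ioi 0) := by
    have hd : ∀ r ∈ Ioi (0 : ℝ), HasDerivAt Q (r ^ 2 * z r - 2 * u r) r := by
      intro r hr
      have h := ((hasDerivAt_pow 2 r).mul (hw r hr)).sub
        (((hasDerivAt_id r).const_mul 2).mul (hu r hr))
      refine h.congr_deriv ?_
      simp
      ring
    refine monotoneOn_of_hasDerivWithinAt_nonneg (convex_Ioi 0)
      (fun r hr => (hd r hr).continuousAt.continuousWithinAt)
      (fun r hr => (hd r (interior_subset hr)).hasDerivWithinAt) fun r hr => ?_
    have h1 := hz r (interior_subset hr)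
    have h2 := hnn r
    linarith
  have hQa : Q a < 0 := by
    have h1 : a ^ 2 * w a ≤ 0 := mul_nonpos_of_nonneg_of_nonpos (by positivity) hwa
    have h2 : 0 < 2 * a * u a := by positivity
    simp only [hQ]
    linarith
  set F : ℝ → ℝ := fun r => u r / r ^ 2 + Q a / 3 / r ^ 3 with hF
  have hFanti : AntitoneOn F (Ioc 0 a) := by
    have hd : ∀ r ∈ Ioc (0 : ℝ) a, HasDerivAt F ((Q r - Q a) / r ^ 4) r := by
      intro r hr
      have hr0 : r ≠ 0 := hr.1.ne'
      have h := ((hu r hr.1).div (hasDerivAt_pow 2 r) (by positivity)).add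
        ((hasDerivAt_const r (Q a / 3)).div (hasDerivAt_pow 3 r) (by positivity))
      refine h.congr_deriv ?_
      generalize Q a = q
      simp only [hQ]
      field_simp
      ring
    refine antitoneOn_of_hasDerivWithinAt_nonpos (convex_Ioc 0 a)
      (fun r hr => (hd r hr).continuousAt.continuousWithinAt)
      (fun r hr => (hd r (interior_subset hr)).hasDerivWithinAt) fun r hr => ?_
    have hr' : r ∈ Ioc 0 a := interior_subset hr
    exact div_nonpos_of_nonpos_of_nonneg (sub_nonpos.2 (hQmono hr'.1 ha hr'.2)) (by positivity)
  have hlow : ∀ r ∈ Ioc (0 : ℝ) a, r⁻¹ ≤ 3 / -Q a * (u r - F a * r ^ 2) := by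
    intro r hr
    have hr0 : 0 < r := hr.1
    have h := hFanti hr ⟨ha0, le_rfl⟩ hr.2
    have h2 : F a * r ^ 2 ≤ F r * r ^ 2 := mul_le_mul_of_nonneg_right h (by positivity)
    have h3 : F r * r ^ 2 = u r + Q a / 3 * r⁻¹ := by
      simp only [hF]
      generalize Q a = q
      field_simp
    rw [div_mul_eq_mul_div, le_div_iff₀ (by linarith)]
    linarith
  have hinv : IntegrableOn (fun r : ℝ => r⁻¹) (Ioc 0 a) := by
    have hpow : IntegrableOn (fun r : ℝ => F a * r ^ 2) (Ioc 0 a) :=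
      (Continuous.integrableOn_Icc (by fun_prop)).mono_set Ioc_subset_Icc_self
    refine Integrable.mono' (((hint.mono_set Ioc_subset_Ioi_self).sub hpow).const_mul (3 / -Q a))
      measurable_inv.aestronglyMeasurable ?_
    filter_upwards [ae_restrict_mem measurableSet_Ioc] with r hr
    rw [Real.norm_of_nonneg (inv_nonneg.2 hr.1.le)]
    exact hlow r hr
  rw [← intervalIntegrable_iff_integrableOn_Ioc_of_le ha0.le, intervalIntegrable_inv_iff] at hinv
  rcases hinv with h | h
  · exact ha0.ne h
  · exact h left_mem_uIcc

/-- For `l ≥ 1`, any twice differentiable square-integrable solution of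
`T_l g = i ρ² g` on `(0,∞)` vanishes identically; hence `T_l` has deficiency
indices `(0,0)` and is essentially self-adjoint. -/
theorem stmt4 (l : ℕ) (hl : 1 ≤ l) (ρ : ℝ) (hρ : 0 < ρ) (g : ℝ → ℂ)
    (hg1 : ∀ r ∈ Ioi (0 : ℝ), DifferentiableAt ℝ g r)
    (hg2 : ∀ r ∈ Ioi (0 : ℝ), DifferentiableAt ℝ (deriv g) r)
    (heq : ∀ r ∈ Ioi (0 : ℝ), Tl l g r = Complex.I * (ρ : ℂ) ^ 2 * g r)
    (hL2 : IntegrableOn (fun r => ‖g r‖ ^ 2) (Ioi 0)) :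
    ∀ r ∈ Ioi (0 : ℝ), g r = 0 := by
  have hu : ∀ r ∈ Ioi (0 : ℝ),
      HasDerivAt (fun r => ‖g r‖ ^ 2) (2 * inner ℝ (g r) (deriv g r)) r :=
    fun r hr => (hg1 r hr).hasDerivAt.norm_sq
  have hw : ∀ r ∈ Ioi (0 : ℝ), HasDerivAt (fun r => 2 * inner ℝ (g r) (deriv g r))
      (2 * (inner ℝ (g r) (deriv (deriv g) r) + inner ℝ (deriv g r) (deriv g r))) r :=
    fun r hr => ((hg1 r hr).hasDerivAt.inner ℝ (hg2 r hr).hasDerivAt).const_mul 2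
  have hz : ∀ r ∈ Ioi (0 : ℝ), 4 * ‖g r‖ ^ 2 ≤
      r ^ 2 * (2 * (inner ℝ (g r) (deriv (deriv g) r) + inner ℝ (deriv g r) (deriv g r))) := by
    intro r hr
    have hr0 : (0 : ℝ) < r := hr
    have hg : deriv (deriv g) r =
        ((l * (l + 1) / r ^ 2 : ℝ) : ℂ) * g r - Complex.I * ((ρ ^ 2 : ℝ) : ℂ) * g r := by
      have h := heq r hr
      simp only [Tl] at h
      push_cast
      linear_combination -h
    have hin : inner ℝ (g r) (deriv (deriv g) r) = l * (l + 1) / r ^ 2 * ‖g r‖ ^ 2 := by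
      rw [hg, Complex.inner, Complex.sq_norm, Complex.normSq_apply]
      generalize (l * (l + 1) / r ^ 2 : ℝ) = c
      generalize ρ ^ 2 = d
      simp
      ring
    have hl' : (1 : ℝ) ≤ l := by exact_mod_cast hl
    have hsq : (0 : ℝ) ≤ inner ℝ (deriv g r) (deriv g r) := real_inner_self_nonneg
    have hc : 2 * ‖g r‖ ^ 2 ≤ (l * (l + 1) : ℝ) * ‖g r‖ ^ 2 :=
      mul_le_mul_of_nonneg_right (by nlinarith) (by positivity)
    have h1 : r ^ 2 * (l * (l + 1) / r ^ 2 * ‖g r‖ ^ 2) = l * (l + 1) * ‖g r‖ ^ 2 := by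
      field_simp
    have h2 : 0 ≤ r ^ 2 * inner ℝ (deriv g r) (deriv g r) := mul_nonneg (by positivity) hsq
    rw [hin]
    linarith
  intro r hr
  simpa using eq_zero_of_integrableOn_of_deriv2_ge hu hw (fun r => by positivity) hz hL2 r hr
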